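/- arXiv:1704.08228 — 2 statements merged into one kernel-verified Lean document; each statement's English description precedes it below -/
import Mathlib

section
/- Let α > 0 and α < m < 2α. Let f be the unique density solution to the equation x^m f(x) = (1/Γ(α)) ∫_0^x (x−v)^{α−1} f(v) dv, and let g be the unique density solution to the equation x^{α} g(x) = (1/Γ(2α−m)) ∫_0^x (x−v)^{2α−m−1} g(v) dv (i.e., the density solution with parameters m' = α and α' = 2α−m). Then for every x > 0, f(x) = (1/Γ(α)) ∫_0^∞ g(xy) · y^{α} · e^{−y} dy. -/
open MeasureTheory Real Set Filter

noncomputable section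

/-- `f` is a density solution to the integro-differential equation
`I^α_{0+} f = x^m f` on `(0,∞)`: `f` is measurable, nonnegative on `(0,∞)`,
integrates to `1` on `(0,∞)`, and satisfies
`x^m f(x) = (1/Γ(α)) ∫_0^x (x−v)^{α−1} f(v) dv` for every `x > 0`. -/
def IsDensitySolution (α m : ℝ) (f : ℝ → ℝ) : Prop :=
  Measurable f ∧ (∀ x ∈ Set.Ioi (0:ℝ), 0 ≤ f x) ∧
  (∫ x in Set.Ioi (0:ℝ), f x) = 1 ∧
  ∀ x ∈ Set.Ioi (0:ℝ),
    x ^ m * f x = (1 / Real.Gamma α) * ∫ v in Set.Ioo (0:ℝ) x, (x - v) ^ (α - 1) * f v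

open ProbabilityTheory Topology
open scoped ENNReal

/-- A convex function whose increments over steps of length `δ` are prescribed by `r`, with
`r` asymptotically slowly varying, is determined on `(0, δ)` by its value at `0`. -/
lemma eqOn_of_convexOn_of_increments {δ : ℝ} (hδ : 0 < δ) {a b r : ℝ → ℝ} {u : ℕ → ℝ}
    (ha : ConvexOn ℝ (Ici 0) a) (hb : ConvexOn ℝ (Ici 0) b) (h0 : a 0 = b 0)
    (har : ∀ t, 0 ≤ t → a (t + δ) = a t + r t) (hbr : ∀ t, 0 ≤ t → b (t + δ) = b t + r t)
    (hu : Tendsto u atTop (𝓝 0)) (hru : ∀ᶠ n : ℕ in atTop, r (n * δ + δ) - r (n * δ) ≤ u n) :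
    EqOn a b (Ioo 0 δ) := by
  intro t ht
  have bounds : ∀ c : ℝ → ℝ, ConvexOn ℝ (Ici 0) c → (∀ t, 0 ≤ t → c (t + δ) = c t + r t) →
      ∀ N, 0 ≤ N → t * r N ≤ δ * (c (N + δ + t) - c (N + δ)) ∧
        δ * (c (N + δ + t) - c (N + δ)) ≤ t * r (N + δ) := by
    intro c hc hcr N hN
    have htp := ht.1
    have h1 := hc.2 (show N ∈ Ici 0 from hN) (show N + δ + t ∈ Ici 0 from by simp; linarith)
      (show 0 ≤ t / (t + δ) by positivity) (show 0 ≤ δ / (t + δ) by positivity) (by field_simp)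
    have h2 := hc.2 (show N + δ ∈ Ici 0 from by simp; linarith)
      (show N + δ + δ ∈ Ici 0 from by simp; linarith)
      (show 0 ≤ (δ - t) / δ from div_nonneg (by linarith [ht.2]) hδ.le)
      (show 0 ≤ t / δ by positivity) (by field_simp; ring)
    have htd : 0 < t + δ := by linarith [ht.1]
    have e1 : (t / (t + δ)) • N + (δ / (t + δ)) • (N + δ + t) = N + δ := by
      simp only [smul_eq_mul]; field_simp; ring
    have e2 : ((δ - t) / δ) • (N + δ) + (t / δ) • (N + δ + δ) = N + δ + t := by
      simp only [smul_eq_mul]; field_simp; ring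
    rw [e1] at h1
    rw [e2] at h2
    simp only [smul_eq_mul] at h1 h2
    rw [hcr _ (by linarith : 0 ≤ N + δ)] at h2
    have h3 := hcr N hN
    rw [div_mul_eq_mul_div, div_mul_eq_mul_div, ← add_div, le_div_iff₀ htd] at h1
    rw [div_mul_eq_mul_div, div_mul_eq_mul_div, ← add_div, le_div_iff₀ hδ] at h2
    constructor
    · nlinarith
    · nlinarith
  have shift : ∀ s, 0 ≤ s → ∀ n : ℕ, a (n * δ + s) - b (n * δ + s) = a s - b s := by
    intro s hs n
    induction n with
    | zero => simp
    | succ k ih =>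
      have e : ((k + 1 : ℕ) : ℝ) * δ + s = (k * δ + s) + δ := by push_cast; ring
      have : 0 ≤ (k : ℝ) * δ + s := by positivity
      rw [e, har _ this, hbr _ this]; linarith
  have key : ∀ᶠ n : ℕ in atTop, |δ * (a t - b t)| ≤ t * u n := by
    filter_upwards [hru] with n hn
    have hN : 0 ≤ (n : ℝ) * δ := by positivity
    have A := bounds a ha har _ hN
    have B := bounds b hb hbr _ hN
    have s1 := shift t ht.1.le (n + 1)
    have s2 := shift 0 le_rfl (n + 1)
    have e : ((n + 1 : ℕ) : ℝ) * δ = n * δ + δ := by push_cast; ring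
    rw [e] at s1 s2
    rw [add_zero] at s2
    have hm := mul_le_mul_of_nonneg_left hn ht.1.le
    have e3 : δ * (a t - b t) = δ * (a (n * δ + δ + t) - a (n * δ + δ))
      - δ * (b (n * δ + δ + t) - b (n * δ + δ)) := by rw [← s1]; linear_combination δ * (s2 + h0)
    rw [e3, abs_le]
    constructor <;> linarith [A.1, A.2, B.1, B.2]
  have lim : Tendsto (fun n => t * u n) atTop (𝓝 0) := by simpa using hu.const_mul t
  have h := abs_nonpos_iff.mp (ge_of_tendsto lim key)
  rcases mul_eq_zero.mp h with h | h
  · exact absurd h hδ.ne'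
  · linarith

lemma log_Gamma_add_sub_le {x c : ℝ} (hx : 0 < x) (hc : 0 < c) :
    log (Gamma (x + c)) - log (Gamma x) ≤ c * log (x + c) := by
  have h := convexOn_log_Gamma.slope_mono_adjacent (x := x) (y := x + c) (z := x + c + 1)
    hx (by simp; linarith) (by linarith) (by linarith)
  simp only [Function.comp] at h
  rw [Gamma_add_one (by linarith), log_mul (by linarith) (Gamma_pos_of_pos (by linarith)).ne',
    div_le_iff₀ (by linarith)] at h
  ring_nf at h ⊢
  linarith

lemma le_log_Gamma_add_sub {x c : ℝ} (hx : 0 < x) (hc : 0 < c) :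
    c * log x ≤ log (Gamma (x + 1 + c)) - log (Gamma (x + 1)) := by
  have h := convexOn_log_Gamma.slope_mono_adjacent (x := x) (y := x + 1) (z := x + 1 + c)
    hx (by simp; linarith) (by linarith) (by linarith)
  simp only [Function.comp] at h
  rw [Gamma_add_one hx.ne', log_mul hx.ne' (Gamma_pos_of_pos hx).ne',
    le_div_iff₀ (by linarith)] at h
  rw [Gamma_add_one hx.ne', log_mul hx.ne' (Gamma_pos_of_pos hx).ne']
  ring_nf at h ⊢
  linarith

lemma tendsto_log_add_sub_log_add (p q : ℝ) :
    Tendsto (fun x => log (x + p) - log (x + q)) atTop (𝓝 0) := by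
  have h : ∀ p : ℝ, Tendsto (fun x => log (x + p) - log x) atTop (𝓝 0) :=
    fun p => tendsto_log_comp_add_sub_log p
  simpa using (h p).sub (h q)

/-- Two finite measures for which the moment generating functions of `X` exist and agree near
the origin give the same law to `X`. -/
lemma map_eq_of_mgf_eq_near_zero {Ω : Type*} [MeasurableSpace Ω] {μ ν : Measure Ω}
    [IsFiniteMeasure μ] [IsFiniteMeasure ν] {X : Ω → ℝ} (hX : Measurable X) {ε : ℝ} (hε : 0 < ε)
    (hμ : ∀ t ∈ Ioo (-ε) ε, Integrable (fun ω => exp (t * X ω)) μ)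
    (hν : ∀ t ∈ Ioo (-ε) ε, Integrable (fun ω => exp (t * X ω)) ν)
    (h : ∀ t ∈ Ioo (-ε) ε, mgf X μ t = mgf X ν t) :
    μ.map X = ν.map X := by
  have iμ : Ioo (-ε) ε ⊆ interior (integrableExpSet X μ) :=
    interior_maximal (fun t ht => hμ t ht) isOpen_Ioo
  have iν : Ioo (-ε) ε ⊆ interior (integrableExpSet X ν) :=
    interior_maximal (fun t ht => hν t ht) isOpen_Ioo
  set S : Set ℂ := {z | z.re ∈ Ioo (-ε) ε}
  have hS : IsPreconnected S :=
    ((convex_Ioo (-ε) ε).linear_preimage Complex.reLm).isPreconnected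
  have aμ : AnalyticOnNhd ℂ (complexMGF X μ) S :=
    analyticOnNhd_complexMGF.mono (fun z hz => iμ hz)
  have aν : AnalyticOnNhd ℂ (complexMGF X ν) S :=
    analyticOnNhd_complexMGF.mono (fun z hz => iν hz)
  have h0 : (0 : ℂ) ∈ S := by simp [S, hε]
  have key : EqOn (complexMGF X μ) (complexMGF X ν) S := by
    refine aμ.eqOn_of_preconnected_of_frequently_eq aν hS h0 ?_
    have hreal : ∀ᶠ t : ℝ in 𝓝[≠] 0, complexMGF X μ t = complexMGF X ν t := by
      filter_upwards [nhdsWithin_le_nhds (Ioo_mem_nhds (neg_lt_zero.mpr hε) hε)] with t ht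
      rw [complexMGF_ofReal, complexMGF_ofReal, h t ht]
    have hmap : Tendsto (fun t : ℝ => (t : ℂ)) (𝓝[≠] 0) (𝓝[≠] 0) := by
      refine tendsto_nhdsWithin_iff.mpr ⟨?_, ?_⟩
      · exact (Complex.continuous_ofReal.tendsto' 0 0 (by simp)).mono_left nhdsWithin_le_nhds
      · filter_upwards [self_mem_nhdsWithin] with t ht
        simpa using ht
    exact hmap.frequently hreal.frequently
  refine Measure.ext_of_charFun ?_
  ext t
  rw [← complexMGF_mul_I hX.aemeasurable, ← complexMGF_mul_I hX.aemeasurable]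
  exact key (by simp [S, hε])

/-- The kernel `u ↦ u ^ (α - 1) / Γ(α)` on `(0, ∞)`, extended by zero. -/
def fracKernel (α : ℝ) : ℝ → ℝ≥0∞ :=
  (Ioi 0).indicator fun u => ENNReal.ofReal (u ^ (α - 1) / Gamma α)

/-- The Riemann–Liouville integral of order `α` of a function on `(0, ∞)`. -/
def fracInt (α : ℝ) (F : ℝ → ℝ≥0∞) (x : ℝ) : ℝ≥0∞ :=
  ∫⁻ v in Ioi 0, fracKernel α (x - v) * F v

/-- The Laplace transform of a function on `(0, ∞)`. -/
def laplaceLI (F : ℝ → ℝ≥0∞) (y : ℝ) : ℝ≥0∞ :=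
  ∫⁻ x in Ioi 0, ENNReal.ofReal (exp (-(y * x))) * F x

/-- The moment of order `-t` of a density on `(0, ∞)`. -/
def negMoment (F : ℝ → ℝ≥0∞) (t : ℝ) : ℝ≥0∞ :=
  ∫⁻ x in Ioi 0, ENNReal.ofReal (x ^ (-t)) * F x

/-- The density of the quotient of a variable with density `G` by a Gamma variable. -/
def gammaMix (α : ℝ) (G : ℝ → ℝ≥0∞) (x : ℝ) : ℝ≥0∞ :=
  ∫⁻ y in Ioi 0, ENNReal.ofReal (y ^ α * exp (-y) / Gamma α) * G (x * y)

/-- `F` solves `I^α F = x ^ m F` almost everywhere on `(0, ∞)`. -/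
def IsAESolution (α m : ℝ) (F : ℝ → ℝ≥0∞) : Prop :=
  ∀ᵐ x ∂(volume.restrict (Ioi (0 : ℝ))), ENNReal.ofReal (x ^ m) * F x = fracInt α F x

@[fun_prop]
lemma measurable_fracKernel (α : ℝ) : Measurable (fracKernel α) :=
  Measurable.indicator (by fun_prop) measurableSet_Ioi

@[fun_prop]
lemma measurable_fracInt (α : ℝ) {F : ℝ → ℝ≥0∞} (hF : Measurable F) :
    Measurable (fracInt α F) := by
  unfold fracInt
  refine Measurable.lintegral_prod_right' (f := fun p : ℝ × ℝ => fracKernel α (p.1 - p.2) * F p.2) ?_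
  fun_prop

lemma lintegral_Ioi_comp_mul_left {c : ℝ} (hc : 0 < c) {φ : ℝ → ℝ≥0∞} (hφ : Measurable φ) :
    ∫⁻ x in Ioi 0, φ (c * x) = ENNReal.ofReal c⁻¹ * ∫⁻ x in Ioi 0, φ x := by
  rw [← lintegral_indicator measurableSet_Ioi, ← lintegral_indicator measurableSet_Ioi]
  have e : (Ioi (0 : ℝ)).indicator (fun x => φ (c * x))
      = fun x => (Ioi (0 : ℝ)).indicator φ (c * x) := by
    ext x
    simp [indicator, hc]
  rw [e, ← lintegral_map (hφ.indicator measurableSet_Ioi) (measurable_const_mul c),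
    Real.map_volume_mul_left hc.ne', lintegral_smul_measure, abs_of_pos (inv_pos.mpr hc),
    smul_eq_mul]

lemma lintegral_rpow_mul_exp {a r : ℝ} (ha : 0 < a) (hr : 0 < r) :
    ∫⁻ x in Ioi 0, ENNReal.ofReal (x ^ (a - 1) * exp (-(r * x)))
      = ENNReal.ofReal (r ^ (-a) * Gamma a) := by
  have hI := integral_rpow_mul_exp_neg_mul_Ioi ha hr
  have hpos : 0 < (1 / r) ^ a * Gamma a := by
    have := Gamma_pos_of_pos ha
    positivity
  have hint : Integrable (fun x : ℝ => x ^ (a - 1) * exp (-(r * x)))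
      (volume.restrict (Ioi 0)) := by
    by_contra h
    rw [integral_undef h] at hI
    exact hpos.ne hI
  rw [← ofReal_integral_eq_lintegral_ofReal hint, hI, one_div, inv_rpow hr.le, rpow_neg hr.le]
  filter_upwards [ae_restrict_mem measurableSet_Ioi] with x hx
  have : (0 : ℝ) < x := hx
  simp only [Pi.zero_apply]
  positivity

lemma lintegral_exp_mul_fracKernel {α y v : ℝ} (hα : 0 < α) (hy : 0 < y) (hv : 0 < v) :
    ∫⁻ x in Ioi 0, ENNReal.ofReal (exp (-(y * x))) * fracKernel α (x - v)
      = ENNReal.ofReal (y ^ (-α)) * ENNReal.ofReal (exp (-(y * v))) := by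
  have hΓ := Gamma_pos_of_pos hα
  have e : (Ioi (0 : ℝ)).indicator
      (fun x => ENNReal.ofReal (exp (-(y * x))) * fracKernel α (x - v))
      = fun x => (fun u => ENNReal.ofReal (exp (-(y * (u + v)))) * fracKernel α u) (x - v) := by
    ext x
    by_cases hx : 0 < x
    · simp [indicator, hx]
    · have : ¬ (v < x) := by linarith
      simp [indicator, hx, fracKernel, this]
  have e2 : (fun u => ENNReal.ofReal (exp (-(y * (u + v)))) * fracKernel α u)
      = (Ioi (0 : ℝ)).indicator (fun u => ENNReal.ofReal (exp (-(y * v)) / Gamma α) *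
          ENNReal.ofReal (u ^ (α - 1) * exp (-(y * u)))) := by
    ext u
    by_cases hu : 0 < u
    · simp only [fracKernel, indicator, mem_Ioi, hu, if_true]
      rw [← ENNReal.ofReal_mul (by positivity), ← ENNReal.ofReal_mul (by positivity)]
      congr 1
      rw [mul_add, neg_add, exp_add]
      ring
    · simp [fracKernel, indicator, hu]
  rw [← lintegral_indicator measurableSet_Ioi, e, lintegral_sub_right_eq_self, e2,
    lintegral_indicator measurableSet_Ioi, lintegral_const_mul _ (by fun_prop),
    lintegral_rpow_mul_exp hα hy, ← ENNReal.ofReal_mul (by positivity),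
    ← ENNReal.ofReal_mul (by positivity)]
  congr 1
  field_simp

lemma laplaceLI_fracInt {α y : ℝ} (hα : 0 < α) (hy : 0 < y) {F : ℝ → ℝ≥0∞} (hF : Measurable F) :
    laplaceLI (fracInt α F) y = ENNReal.ofReal (y ^ (-α)) * laplaceLI F y := by
  unfold laplaceLI fracInt
  have h1 : ∀ x, ENNReal.ofReal (exp (-(y * x))) * ∫⁻ v in Ioi 0, fracKernel α (x - v) * F v
      = ∫⁻ v in Ioi 0, ENNReal.ofReal (exp (-(y * x))) * (fracKernel α (x - v) * F v) := by
    intro x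
    rw [lintegral_const_mul _ (by fun_prop)]
  simp_rw [h1]
  rw [lintegral_lintegral_swap (by fun_prop), ← lintegral_const_mul _ (by fun_prop)]
  refine setLIntegral_congr_fun measurableSet_Ioi fun v hv => ?_
  simp only [← mul_assoc]
  rw [lintegral_mul_const _ (by fun_prop), lintegral_exp_mul_fracKernel hα hy hv]

lemma Gamma_mul_negMoment {s : ℝ} (hs : 0 < s) {H : ℝ → ℝ≥0∞} (hH : Measurable H) :
    ENNReal.ofReal (Gamma s) * negMoment H s
      = ∫⁻ y in Ioi 0, ENNReal.ofReal (y ^ (s - 1)) * laplaceLI H y := by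
  unfold laplaceLI negMoment
  have h1 : ∀ y, ENNReal.ofReal (y ^ (s - 1)) *
        ∫⁻ x in Ioi 0, ENNReal.ofReal (exp (-(y * x))) * H x
      = ∫⁻ x in Ioi 0, ENNReal.ofReal (y ^ (s - 1)) * (ENNReal.ofReal (exp (-(y * x))) * H x) := by
    intro x
    rw [lintegral_const_mul _ (by fun_prop)]
  simp_rw [h1]
  rw [lintegral_lintegral_swap (by fun_prop), ← lintegral_const_mul _ (by fun_prop)]
  refine setLIntegral_congr_fun measurableSet_Ioi fun x hx => ?_
  have hx' : (0 : ℝ) < x := hx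
  simp only [← mul_assoc]
  rw [lintegral_mul_const _ (by fun_prop)]
  congr 1
  rw [← ENNReal.ofReal_mul (Gamma_pos_of_pos hs).le, mul_comm, ← lintegral_rpow_mul_exp hs hx']
  refine setLIntegral_congr_fun measurableSet_Ioi fun y hy => ?_
  have hy' : (0 : ℝ) < y := hy
  rw [← ENNReal.ofReal_mul (by positivity), mul_comm x y]

lemma IsAESolution.negMoment_eq {α m t : ℝ} (hα : 0 < α) (ht : 0 < t + (m - α)) {F : ℝ → ℝ≥0∞}
    (hF : Measurable F) (h : IsAESolution α m F) :
    negMoment F (t + (m - α))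
      = ENNReal.ofReal (Gamma (t + m) / Gamma (t + (m - α))) * negMoment F t := by
  have hs : 0 < t + m := by linarith
  have e1 : negMoment (fracInt α F) (t + m) = negMoment F t := by
    unfold negMoment
    refine lintegral_congr_ae ?_
    filter_upwards [h, ae_restrict_mem measurableSet_Ioi] with x hx hx0
    have hx0' : (0 : ℝ) < x := hx0
    rw [← hx, ← mul_assoc, ← ENNReal.ofReal_mul (by positivity), ← rpow_add hx0']
    congr 3
    ring
  have e2 : ENNReal.ofReal (Gamma (t + m)) * negMoment (fracInt α F) (t + m)
      = ENNReal.ofReal (Gamma (t + (m - α))) * negMoment F (t + (m - α)) := by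
    rw [Gamma_mul_negMoment hs (by fun_prop), Gamma_mul_negMoment ht hF]
    refine setLIntegral_congr_fun measurableSet_Ioi fun y hy => ?_
    have hy' : (0 : ℝ) < y := hy
    rw [laplaceLI_fracInt hα hy' hF, ← mul_assoc, ← ENNReal.ofReal_mul (by positivity),
      ← rpow_add hy']
    congr 3
    ring
  have g1 := Gamma_pos_of_pos hs
  have g2 := Gamma_pos_of_pos ht
  rw [e1] at e2
  rw [div_eq_mul_inv, mul_comm (Gamma (t + m)), ENNReal.ofReal_mul (by positivity), mul_assoc, e2,
    ← mul_assoc, ← ENNReal.ofReal_mul (by positivity), inv_mul_cancel₀ g2.ne', ENNReal.ofReal_one,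
    one_mul]

lemma negMoment_gammaMix_zero {α : ℝ} (hα : 0 < α) {G : ℝ → ℝ≥0∞} (hG : Measurable G) :
    negMoment (gammaMix α G) 0 = negMoment G 0 := by
  have hΓ := Gamma_pos_of_pos hα
  simp only [negMoment, gammaMix, neg_zero, rpow_zero, ENNReal.ofReal_one, one_mul]
  rw [lintegral_lintegral_swap (by fun_prop)]
  have h1 : ∀ y ∈ Ioi (0 : ℝ), ∫⁻ x in Ioi 0,
        ENNReal.ofReal (y ^ α * exp (-y) / Gamma α) * G (x * y)
      = ENNReal.ofReal (y ^ (α - 1) * exp (-(1 * y))) *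
        (ENNReal.ofReal (Gamma α)⁻¹ * ∫⁻ x in Ioi 0, G x) := by
    intro y hy
    have hy' : (0 : ℝ) < y := hy
    rw [lintegral_const_mul _ (by fun_prop)]
    simp_rw [mul_comm _ y]
    rw [lintegral_Ioi_comp_mul_left hy' hG, ← mul_assoc, ← mul_assoc,
      ← ENNReal.ofReal_mul (by positivity), ← ENNReal.ofReal_mul (by positivity),
      rpow_sub_one hy'.ne', mul_one]
    congr 2
    ring
  rw [setLIntegral_congr_fun measurableSet_Ioi h1, lintegral_mul_const _ (by fun_prop),
    lintegral_rpow_mul_exp hα one_pos, ← mul_assoc, ← ENNReal.ofReal_mul (by positivity)]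
  simp [hΓ.ne']

lemma fracInt_comp_mul {α x y : ℝ} (hy : 0 < y) {G : ℝ → ℝ≥0∞}
    (hG : Measurable G) :
    ∫⁻ v in Ioi 0, fracKernel α (x - v) * G (v * y)
      = ENNReal.ofReal (y ^ (-α)) * fracInt α G (x * y) := by
  have hk : ∀ u, fracKernel α u = ENNReal.ofReal (y ^ (1 - α)) * fracKernel α (u * y) := by
    intro u
    by_cases hu : 0 < u
    · have : 0 < u * y := by positivity
      simp only [fracKernel, indicator, mem_Ioi, hu, this, if_true]
      rw [← ENNReal.ofReal_mul (by positivity), mul_rpow hu.le hy.le, ← neg_sub α 1,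
        rpow_neg hy.le]
      congr 1
      have := (rpow_pos_of_pos hy (α - 1)).ne'
      field_simp
    · have : ¬ 0 < u * y := by rw [mul_pos_iff_of_pos_right hy]; exact hu
      simp only [fracKernel, indicator, mem_Ioi, hu, this, if_false, mul_zero]
  have e : ∀ v, fracKernel α (x - v) * G (v * y) = (fun z => ENNReal.ofReal (y ^ (1 - α)) *
      (fracKernel α (x * y - z) * G z)) (y * v) := by
    intro v
    simp only
    rw [hk (x - v), sub_mul, mul_comm v y, mul_assoc]
  simp_rw [e]
  rw [lintegral_Ioi_comp_mul_left hy (φ := fun z => ENNReal.ofReal (y ^ (1 - α)) *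
      (fracKernel α (x * y - z) * G z)) (by fun_prop), lintegral_const_mul _ (by fun_prop),
    ← mul_assoc, ← ENNReal.ofReal_mul (by positivity), ← rpow_neg_one y, ← rpow_add hy]
  unfold fracInt
  congr 3
  ring

lemma fracInt_gammaMix {α x : ℝ} (hα : 0 < α) (hx : 0 < x) {G : ℝ → ℝ≥0∞} (hG : Measurable G) :
    fracInt α (gammaMix α G) x
      = ENNReal.ofReal (x ^ (α - 1) / Gamma α) * laplaceLI G x⁻¹ := by
  have hΓ := Gamma_pos_of_pos hα
  have h1 : ∀ v, fracKernel α (x - v) * gammaMix α G v = ∫⁻ y in Ioi 0,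
      ENNReal.ofReal (y ^ α * exp (-y) / Gamma α) * (fracKernel α (x - v) * G (v * y)) := by
    intro v
    unfold gammaMix
    rw [← lintegral_const_mul _ (by fun_prop)]
    refine lintegral_congr fun y => ?_
    ring
  rw [fracInt]
  simp_rw [h1]
  rw [lintegral_lintegral_swap (by fun_prop)]
  have h2 : ∀ y ∈ Ioi (0 : ℝ), ∫⁻ v in Ioi 0,
        ENNReal.ofReal (y ^ α * exp (-y) / Gamma α) * (fracKernel α (x - v) * G (v * y))
      = (fun z => ENNReal.ofReal (Gamma α)⁻¹ *
        (ENNReal.ofReal (exp (-(x⁻¹ * z))) * fracInt α G z)) (x * y) := by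
    intro y hy
    have hy' : (0 : ℝ) < y := hy
    simp only
    rw [lintegral_const_mul _ (by fun_prop), fracInt_comp_mul hy' hG, ← mul_assoc, ← mul_assoc,
      ← ENNReal.ofReal_mul (by positivity), ← ENNReal.ofReal_mul (by positivity),
      rpow_neg hy'.le, inv_mul_cancel_left₀ hx.ne']
    congr 2
    have := (rpow_pos_of_pos hy' α).ne'
    field_simp
  rw [setLIntegral_congr_fun measurableSet_Ioi h2, lintegral_Ioi_comp_mul_left hx
    (φ := fun z => ENNReal.ofReal (Gamma α)⁻¹ *
        (ENNReal.ofReal (exp (-(x⁻¹ * z))) * fracInt α G z)) (by fun_prop),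
    lintegral_const_mul _ (by fun_prop)]
  change _ * (_ * laplaceLI (fracInt α G) x⁻¹) = _
  rw [laplaceLI_fracInt hα (inv_pos.mpr hx) hG, ← mul_assoc, ← mul_assoc,
    ← ENNReal.ofReal_mul (by positivity), ← ENNReal.ofReal_mul (by positivity),
    inv_rpow hx.le, rpow_neg hx.le, inv_inv, rpow_sub_one hx.ne']
  congr 2
  field_simp

lemma rpow_mul_gammaMix {α β m x : ℝ} (hα : 0 < α) (hβ : 0 < β) (hx : 0 < x) {G : ℝ → ℝ≥0∞}
    (hG : Measurable G) (h : IsAESolution β α G) :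
    ENNReal.ofReal (x ^ m) * gammaMix α G x
      = ENNReal.ofReal (x ^ (m + β - α - 1) / Gamma α) * laplaceLI G x⁻¹ := by
  have hΓ := Gamma_pos_of_pos hα
  have h2 : ∀ y ∈ Ioi (0 : ℝ), ENNReal.ofReal (y ^ α * exp (-y) / Gamma α) * G (x * y)
      = (fun z => ENNReal.ofReal (x ^ (-α) / Gamma α) *
        (ENNReal.ofReal (exp (-(x⁻¹ * z))) * (ENNReal.ofReal (z ^ α) * G z))) (x * y) := by
    intro y hy
    have hy' : (0 : ℝ) < y := hy
    simp only
    rw [← mul_assoc, ← mul_assoc,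
      ← ENNReal.ofReal_mul (by positivity), ← ENNReal.ofReal_mul (by positivity),
      rpow_neg hx.le, inv_mul_cancel_left₀ hx.ne', mul_rpow hx.le hy'.le]
    congr 2
    have := (rpow_pos_of_pos hx α).ne'
    field_simp
  have e : ∫⁻ z in Ioi 0, ENNReal.ofReal (exp (-(x⁻¹ * z))) * (ENNReal.ofReal (z ^ α) * G z)
      = laplaceLI (fracInt β G) x⁻¹ := by
    refine lintegral_congr_ae ?_
    filter_upwards [h] with z hz
    rw [hz]
  rw [gammaMix, setLIntegral_congr_fun measurableSet_Ioi h2, lintegral_Ioi_comp_mul_left hx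
    (φ := fun z => ENNReal.ofReal (x ^ (-α) / Gamma α) *
        (ENNReal.ofReal (exp (-(x⁻¹ * z))) * (ENNReal.ofReal (z ^ α) * G z))) (by fun_prop),
    lintegral_const_mul _ (by fun_prop), e,
    laplaceLI_fracInt hβ (inv_pos.mpr hx) hG, ← mul_assoc, ← mul_assoc, ← mul_assoc,
    ← ENNReal.ofReal_mul (by positivity), ← ENNReal.ofReal_mul (by positivity),
    ← ENNReal.ofReal_mul (by positivity), inv_rpow hx.le, rpow_neg hx.le β, inv_inv]
  congr 2
  rw [show m + β - α - 1 = m + (-1) + (-α) + β by ring, rpow_add hx, rpow_add hx, rpow_add hx,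
    rpow_neg_one]
  ring

lemma gammaMix_solution {α m x : ℝ} (hα : 0 < α) (hm : m < 2 * α) (hx : 0 < x) {G : ℝ → ℝ≥0∞}
    (hG : Measurable G) (h : IsAESolution (2 * α - m) α G) :
    ENNReal.ofReal (x ^ m) * gammaMix α G x = fracInt α (gammaMix α G) x := by
  rw [rpow_mul_gammaMix hα (by linarith) hx hG h, fracInt_gammaMix hα hx hG]
  congr 4
  ring

@[fun_prop]
lemma measurable_gammaMix (α : ℝ) {G : ℝ → ℝ≥0∞} (hG : Measurable G) :
    Measurable (gammaMix α G) := by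
  unfold gammaMix
  refine Measurable.lintegral_prod_right' (f := fun p : ℝ × ℝ =>
    ENNReal.ofReal (p.2 ^ α * exp (-p.2) / Gamma α) * G (p.1 * p.2)) ?_
  fun_prop

lemma negMoment_ne_zero {F : ℝ → ℝ≥0∞} (hF : Measurable F) (h1 : negMoment F 0 = 1) (t : ℝ) :
    negMoment F t ≠ 0 := by
  intro h
  rw [negMoment, lintegral_eq_zero_iff (by fun_prop)] at h
  have : negMoment F 0 = 0 := by
    rw [negMoment, lintegral_eq_zero_iff (by fun_prop)]
    filter_upwards [h, ae_restrict_mem measurableSet_Ioi] with x hx hx0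
    have hx0' : (0 : ℝ) < x := hx0
    have hp : ENNReal.ofReal (x ^ (-t)) ≠ 0 := by
      simpa using rpow_pos_of_pos hx0' (-t)
    simp only [Pi.zero_apply, mul_eq_zero, hp, false_or] at hx
    simp [hx]
  simp [this] at h1

lemma IsAESolution.negMoment_ne_top {α m t : ℝ} (hα : 0 < α) (hm : α < m) (ht : 0 ≤ t)
    {F : ℝ → ℝ≥0∞} (hF : Measurable F) (h1 : negMoment F 0 = 1) (h : IsAESolution α m F) :
    negMoment F t ≠ ∞ := by
  have hδ : 0 < m - α := by linarith
  have hn : ∀ n : ℕ, negMoment F (n * (m - α)) ≠ ∞ := by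
    intro n
    induction n with
    | zero => simp [h1]
    | succ k ih =>
      have e : ((k + 1 : ℕ) : ℝ) * (m - α) = k * (m - α) + (m - α) := by push_cast; ring
      rw [e, h.negMoment_eq hα (by positivity) hF]
      exact ENNReal.mul_ne_top ENNReal.ofReal_ne_top ih
  obtain ⟨n, hnt⟩ := exists_nat_ge (t / (m - α))
  rw [div_le_iff₀ hδ] at hnt
  have hle : negMoment F t ≤ negMoment F 0 + negMoment F (n * (m - α)) := by
    unfold negMoment
    rw [← lintegral_add_left (by fun_prop)]
    refine setLIntegral_mono (by fun_prop) fun x hx => ?_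
    have hx' : (0 : ℝ) < x := hx
    rw [← add_mul, ← ENNReal.ofReal_add (by positivity) (by positivity)]
    gcongr
    rcases le_total 1 x with hx1 | hx1
    · have a1 := rpow_le_rpow_of_exponent_le hx1 (by linarith : -t ≤ -0)
      have a2 := rpow_pos_of_pos hx' (-(n * (m - α)))
      linarith
    · have a1 := rpow_le_rpow_of_exponent_ge hx' hx1 (by linarith : -(n * (m - α)) ≤ -t)
      have a2 := rpow_pos_of_pos hx' (-0)
      linarith
  refine ne_top_of_le_ne_top ?_ hle
  simp [h1, hn n]

lemma convexOn_log_negMoment {F : ℝ → ℝ≥0∞} (hF : Measurable F) {s : Set ℝ} (hs : Convex ℝ s)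
    (h0 : ∀ t, negMoment F t ≠ 0) (htop : ∀ t ∈ s, negMoment F t ≠ ∞) :
    ConvexOn ℝ s fun t => log (negMoment F t).toReal := by
  refine ⟨hs, fun a ha b hb p q hp hq hpq => ?_⟩
  have key : negMoment F (p * a + q * b) ≤ negMoment F a ^ p * negMoment F b ^ q := by
    refine le_trans (le_of_eq ?_) (ENNReal.lintegral_mul_norm_pow_le
      (f := fun x => ENNReal.ofReal (x ^ (-a)) * F x)
      (g := fun x => ENNReal.ofReal (x ^ (-b)) * F x)
      (by fun_prop) (by fun_prop) hp hq hpq)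
    refine setLIntegral_congr_fun measurableSet_Ioi fun x hx => ?_
    have hx' : (0 : ℝ) < x := hx
    have hFx : F x = F x ^ p * F x ^ q := by
      rw [← ENNReal.rpow_add_of_nonneg _ _ hp hq, hpq, ENNReal.rpow_one]
    have e : ENNReal.ofReal (x ^ (-(p * a + q * b)))
        = ENNReal.ofReal (x ^ (-a)) ^ p * ENNReal.ofReal (x ^ (-b)) ^ q := by
      rw [ENNReal.ofReal_rpow_of_pos (by positivity), ENNReal.ofReal_rpow_of_pos (by positivity),
        ← ENNReal.ofReal_mul (by positivity), ← rpow_mul hx'.le, ← rpow_mul hx'.le,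
        ← rpow_add hx']
      congr 2
      ring
    rw [ENNReal.mul_rpow_of_nonneg _ _ hp, ENNReal.mul_rpow_of_nonneg _ _ hq, e]
    nth_rewrite 1 [hFx]
    ring
  have pa := ENNReal.toReal_pos (h0 a) (htop a ha)
  have pb := ENNReal.toReal_pos (h0 b) (htop b hb)
  have hab : p • a + q • b ∈ s := hs ha hb hp hq hpq
  have pab := ENNReal.toReal_pos (h0 _) (htop _ hab)
  have htop' : negMoment F a ^ p * negMoment F b ^ q ≠ ∞ :=
    ENNReal.mul_ne_top (ENNReal.rpow_ne_top_of_nonneg hp (htop a ha))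
      (ENNReal.rpow_ne_top_of_nonneg hq (htop b hb))
  have key' := ENNReal.toReal_mono htop' key
  rw [ENNReal.toReal_mul, ← ENNReal.toReal_rpow, ← ENNReal.toReal_rpow] at key'
  simp only [smul_eq_mul] at pab ⊢
  refine (log_le_log pab key').trans_eq ?_
  rw [log_mul (rpow_pos_of_pos pa p).ne' (rpow_pos_of_pos pb q).ne', log_rpow pa, log_rpow pb]

lemma negMoment_eqOn {α m : ℝ} (hα : 0 < α) (hm : α < m) {F₁ F₂ : ℝ → ℝ≥0∞}
    (hF₁ : Measurable F₁) (hF₂ : Measurable F₂) (h₁ : IsAESolution α m F₁)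
    (h₂ : IsAESolution α m F₂) (hn₁ : negMoment F₁ 0 = 1) (hn₂ : negMoment F₂ 0 = 1) :
    EqOn (negMoment F₁) (negMoment F₂) (Ioo 0 (m - α)) := by
  set δ := m - α with hδ_def
  have hδ : 0 < δ := by linarith
  have conv : ∀ F : ℝ → ℝ≥0∞, Measurable F → IsAESolution α m F → negMoment F 0 = 1 →
      ConvexOn ℝ (Ici 0) fun t => log (negMoment F t).toReal := fun F hF h h1 =>
    convexOn_log_negMoment hF (convex_Ici 0) (negMoment_ne_zero hF h1)
      (fun t ht => h.negMoment_ne_top hα hm ht hF h1)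
  set r : ℝ → ℝ := fun t => log (Gamma (t + m)) - log (Gamma (t + δ)) with hr
  have incr : ∀ F : ℝ → ℝ≥0∞, Measurable F → IsAESolution α m F → negMoment F 0 = 1 →
      ∀ t, 0 ≤ t → log (negMoment F (t + δ)).toReal = log (negMoment F t).toReal + r t := by
    intro F hF h h1 t ht
    have g1 := Gamma_pos_of_pos (by linarith : 0 < t + m)
    have g2 := Gamma_pos_of_pos (by linarith : 0 < t + δ)
    have p := ENNReal.toReal_pos (negMoment_ne_zero hF h1 t) (h.negMoment_ne_top hα hm ht hF h1)
    rw [h.negMoment_eq hα (by linarith) hF, ← hδ_def, ENNReal.toReal_mul,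
      ENNReal.toReal_ofReal (by positivity), log_mul (by positivity) p.ne',
      log_div g1.ne' g2.ne', hr]
    ring
  have hlim : Tendsto (fun n : ℕ => (n : ℝ) * δ) atTop atTop :=
    tendsto_natCast_atTop_atTop.atTop_mul_const hδ
  have hu : Tendsto (fun n : ℕ => δ * (log (n * δ + (m + δ)) - log (n * δ + (δ - 1))))
      atTop (𝓝 0) := by
    simpa using ((tendsto_log_add_sub_log_add (m + δ) (δ - 1)).comp hlim).const_mul δ
  have hru : ∀ᶠ n : ℕ in atTop, r (n * δ + δ) - r (n * δ)
      ≤ δ * (log (n * δ + (m + δ)) - log (n * δ + (δ - 1))) := by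
    filter_upwards [hlim.eventually_ge_atTop 1] with n hn
    have u1 := log_Gamma_add_sub_le (x := n * δ + m) (c := δ) (by linarith) hδ
    have u2 := le_log_Gamma_add_sub (x := n * δ + (δ - 1)) (c := δ) (by linarith) hδ
    simp only [hr]
    rw [show n * δ + (δ - 1) + 1 = n * δ + δ by ring] at u2
    rw [show (n : ℝ) * δ + m + δ = n * δ + δ + m by ring] at u1
    rw [show (n : ℝ) * δ + (m + δ) = n * δ + δ + m by ring]
    linarith
  have key := eqOn_of_convexOn_of_increments hδ (conv F₁ hF₁ h₁ hn₁) (conv F₂ hF₂ h₂ hn₂)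
    (by simp [hn₁, hn₂]) (incr F₁ hF₁ h₁ hn₁) (incr F₂ hF₂ h₂ hn₂) hu hru
  intro t ht
  have t1 := h₁.negMoment_ne_top hα hm ht.1.le hF₁ hn₁
  have t2 := h₂.negMoment_ne_top hα hm ht.1.le hF₂ hn₂
  rw [← ENNReal.toReal_eq_toReal_iff' t1 t2]
  exact log_injOn_pos (ENNReal.toReal_pos (negMoment_ne_zero hF₁ hn₁ t) t1)
    (ENNReal.toReal_pos (negMoment_ne_zero hF₂ hn₂ t) t2) (key ht)

/-- The measure on `(0, ∞)` with density `x ^ (-c) * F x`. -/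
def tiltedMeasure (c : ℝ) (F : ℝ → ℝ≥0∞) : Measure ℝ :=
  (volume.restrict (Ioi 0)).withDensity fun x => ENNReal.ofReal (x ^ (-c)) * F x

lemma lintegral_exp_tiltedMeasure (c t : ℝ) {F : ℝ → ℝ≥0∞} (hF : Measurable F) :
    ∫⁻ x, ENNReal.ofReal (exp (t * -log x)) ∂tiltedMeasure c F = negMoment F (t + c) := by
  rw [tiltedMeasure, lintegral_withDensity_eq_lintegral_mul _ (by fun_prop) (by fun_prop)]
  refine setLIntegral_congr_fun measurableSet_Ioi fun x hx => ?_
  have hx' : (0 : ℝ) < x := hx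
  have e : exp (t * -log x) = x ^ (-t) := by
    rw [rpow_def_of_pos hx']; ring_nf
  simp only [Pi.mul_apply]
  rw [e, mul_right_comm, ← ENNReal.ofReal_mul (by positivity), ← rpow_add hx']
  congr 3
  ring

lemma integrable_exp_tiltedMeasure {c t : ℝ} {F : ℝ → ℝ≥0∞} (hF : Measurable F)
    (h : negMoment F (t + c) ≠ ∞) :
    Integrable (fun x => exp (t * -log x)) (tiltedMeasure c F) := by
  refine ⟨by fun_prop, ?_⟩
  rw [hasFiniteIntegral_iff_ofReal (ae_of_all _ fun x => (exp_pos _).le),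
    lintegral_exp_tiltedMeasure c t hF]
  exact h.lt_top

lemma mgf_tiltedMeasure (c t : ℝ) {F : ℝ → ℝ≥0∞} (hF : Measurable F) :
    mgf (fun x => -log x) (tiltedMeasure c F) t = (negMoment F (t + c)).toReal := by
  rw [mgf, integral_eq_lintegral_of_nonneg_ae (ae_of_all _ fun x => (exp_pos _).le)
    (by fun_prop), lintegral_exp_tiltedMeasure c t hF]

/-- A density is determined by its moments of negative orders in an open interval. -/
lemma ae_eq_of_negMoment_eq {c : ℝ} (hc : 0 < c) {F₁ F₂ : ℝ → ℝ≥0∞}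
    (hF₁ : Measurable F₁) (hF₂ : Measurable F₂)
    (htop : ∀ t ∈ Ioo 0 (2 * c), negMoment F₁ t ≠ ∞)
    (h : EqOn (negMoment F₁) (negMoment F₂) (Ioo 0 (2 * c))) :
    F₁ =ᵐ[volume.restrict (Ioi 0)] F₂ := by
  have mem : ∀ t ∈ Ioo (-c) c, t + c ∈ Ioo 0 (2 * c) := fun t ht =>
    ⟨by linarith [ht.1], by linarith [ht.2]⟩
  have fin : ∀ F : ℝ → ℝ≥0∞, Measurable F → negMoment F c ≠ ∞ →
      IsFiniteMeasure (tiltedMeasure c F) := by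
    intro F hF hne
    refine ⟨?_⟩
    have := lintegral_exp_tiltedMeasure c 0 hF
    simp only [zero_mul, exp_zero, ENNReal.ofReal_one, lintegral_one, zero_add] at this
    rw [this]
    exact hne.lt_top
  have hcm : c ∈ Ioo 0 (2 * c) := ⟨hc, by linarith⟩
  have := fin F₁ hF₁ (htop c hcm)
  have := fin F₂ hF₂ (h hcm ▸ htop c hcm)
  have hmap : (tiltedMeasure c F₁).map (fun x => -log x)
      = (tiltedMeasure c F₂).map (fun x => -log x) := by
    refine map_eq_of_mgf_eq_near_zero (by fun_prop) hc
      (fun t ht => integrable_exp_tiltedMeasure hF₁ (htop _ (mem t ht)))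
      (fun t ht => integrable_exp_tiltedMeasure hF₂ (h (mem t ht) ▸ htop _ (mem t ht)))
      (fun t ht => ?_)
    rw [mgf_tiltedMeasure c t hF₁, mgf_tiltedMeasure c t hF₂, h (mem t ht)]
  have back : ∀ F : ℝ → ℝ≥0∞,
      ((tiltedMeasure c F).map (fun x => -log x)).map (fun u => exp (-u)) = tiltedMeasure c F := by
    intro F
    rw [Measure.map_map (by fun_prop) (by fun_prop)]
    conv_rhs => rw [← Measure.map_id (μ := tiltedMeasure c F)]
    refine Measure.map_congr ?_
    have hac : tiltedMeasure c F ≪ volume.restrict (Ioi 0) := withDensity_absolutelyContinuous _ _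
    refine hac.ae_le ?_
    filter_upwards [ae_restrict_mem measurableSet_Ioi] with x hx
    simp [exp_log hx]
  have hμ : tiltedMeasure c F₁ = tiltedMeasure c F₂ := by
    rw [← back F₁, ← back F₂, hmap]
  have hae := (withDensity_eq_iff_of_sigmaFinite (by fun_prop) (by fun_prop)).mp hμ
  filter_upwards [hae, ae_restrict_mem measurableSet_Ioi] with x hx hx0
  have hp : ENNReal.ofReal (x ^ (-c)) ≠ 0 := by
    simpa using rpow_pos_of_pos hx0 (-c)
  exact (ENNReal.mul_right_inj hp ENNReal.ofReal_ne_top).mp hx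

lemma IsAESolution.ae_eq {α m : ℝ} (hα : 0 < α) (hm : α < m) {F₁ F₂ : ℝ → ℝ≥0∞}
    (hF₁ : Measurable F₁) (hF₂ : Measurable F₂) (h₁ : IsAESolution α m F₁)
    (h₂ : IsAESolution α m F₂) (hn₁ : negMoment F₁ 0 = 1) (hn₂ : negMoment F₂ 0 = 1) :
    F₁ =ᵐ[volume.restrict (Ioi 0)] F₂ := by
  have e : 2 * ((m - α) / 2) = m - α := by ring
  refine ae_eq_of_negMoment_eq (c := (m - α) / 2) (by linarith) hF₁ hF₂ (fun t ht => ?_) ?_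
  · exact h₁.negMoment_ne_top hα hm ht.1.le hF₁ hn₁
  · rw [e]
    exact negMoment_eqOn hα hm hF₁ hF₂ h₁ h₂ hn₁ hn₂

lemma toReal_fracInt {α x : ℝ} (hα : 0 < α) {f : ℝ → ℝ} (hf : Measurable f)
    (hf0 : ∀ v ∈ Ioi (0 : ℝ), 0 ≤ f v) :
    (1 / Gamma α) * ∫ v in Ioo 0 x, (x - v) ^ (α - 1) * f v
      = (fracInt α (fun v => ENNReal.ofReal (f v)) x).toReal := by
  have hΓ := Gamma_pos_of_pos hα
  rw [integral_eq_lintegral_of_nonneg_ae ?_ (by fun_prop)]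
  · have hc : 1 / Gamma α = (ENNReal.ofReal (1 / Gamma α)).toReal :=
      (ENNReal.toReal_ofReal (by positivity)).symm
    rw [hc, ← ENNReal.toReal_mul, ← lintegral_const_mul _ (by fun_prop), fracInt,
      ← lintegral_indicator measurableSet_Ioo, ← lintegral_indicator measurableSet_Ioi]
    congr 1
    refine lintegral_congr fun v => ?_
    by_cases hv : 0 < v
    · by_cases hvx : v < x
      · have hp : 0 < x - v := by linarith
        have := hf0 v hv
        simp only [fracKernel, indicator, mem_Ioo, mem_Ioi, hv, hvx, hp, and_self, if_true]
        rw [← ENNReal.ofReal_mul (by positivity), ← ENNReal.ofReal_mul (by positivity)]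
        congr 1
        ring
      · simp [fracKernel, indicator, hv, hvx]
    · simp [indicator, hv]
  · filter_upwards [ae_restrict_mem measurableSet_Ioo] with v hv
    have := hf0 v hv.1
    have := rpow_nonneg (sub_nonneg.mpr hv.2.le) (α - 1)
    simp only [Pi.zero_apply]
    positivity

lemma IsDensitySolution.negMoment_zero {α m : ℝ} {f : ℝ → ℝ} (h : IsDensitySolution α m f) :
    negMoment (fun v => ENNReal.ofReal (f v)) 0 = 1 := by
  obtain ⟨-, h0, h1, -⟩ := h
  have hint : Integrable f (volume.restrict (Ioi 0)) := by
    by_contra hn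
    rw [integral_undef hn] at h1
    exact zero_ne_one h1
  simp only [negMoment, neg_zero, rpow_zero, ENNReal.ofReal_one, one_mul]
  rw [← ofReal_integral_eq_lintegral_ofReal hint, h1, ENNReal.ofReal_one]
  filter_upwards [ae_restrict_mem measurableSet_Ioi] with x hx using h0 x hx

lemma IsDensitySolution.isAESolution {α m : ℝ} (hα : 0 < α) {f : ℝ → ℝ}
    (h : IsDensitySolution α m f) : IsAESolution α m fun v => ENNReal.ofReal (f v) := by
  have hm1 := h.negMoment_zero
  obtain ⟨hf, h0, -, heq⟩ := h
  have hF : Measurable fun v => ENNReal.ofReal (f v) := by fun_prop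
  have hle : laplaceLI (fun v => ENNReal.ofReal (f v)) 1 ≤ 1 := by
    rw [← hm1]
    refine setLIntegral_mono (by fun_prop) fun x hx => ?_
    have hx' : (0 : ℝ) < x := hx
    gcongr
    simp [hx'.le]
  have hfin : laplaceLI (fracInt α fun v => ENNReal.ofReal (f v)) 1 ≠ ∞ := by
    rw [laplaceLI_fracInt hα one_pos hF]
    exact ENNReal.mul_ne_top ENNReal.ofReal_ne_top (ne_top_of_le_ne_top ENNReal.one_ne_top hle)
  filter_upwards [ae_lt_top (by fun_prop) hfin, ae_restrict_mem measurableSet_Ioi] with x hx hx0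
  have hx0' : (0 : ℝ) < x := hx0
  have hp : ENNReal.ofReal (exp (-(1 * x))) ≠ 0 := by simpa using exp_pos _
  have hne : fracInt α (fun v => ENNReal.ofReal (f v)) x ≠ ∞ := by
    intro ht
    rw [ht, ENNReal.mul_top hp] at hx
    exact lt_irrefl _ hx
  rw [← ENNReal.ofReal_mul (by positivity), heq x hx0, toReal_fracInt hα hf h0,
    ENNReal.ofReal_toReal hne]

lemma toReal_gammaMix {α x : ℝ} (hα : 0 < α) (hx : 0 < x) {g : ℝ → ℝ} (hg : Measurable g)
    (hg0 : ∀ v ∈ Ioi (0 : ℝ), 0 ≤ g v) :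
    (gammaMix α (fun v => ENNReal.ofReal (g v)) x).toReal
      = (1 / Gamma α) * ∫ y in Ioi 0, g (x * y) * y ^ α * exp (-y) := by
  have hΓ := Gamma_pos_of_pos hα
  rw [integral_eq_lintegral_of_nonneg_ae ?_ (by fun_prop)]
  · have hc : 1 / Gamma α = (ENNReal.ofReal (1 / Gamma α)).toReal :=
      (ENNReal.toReal_ofReal (by positivity)).symm
    rw [hc, ← ENNReal.toReal_mul, ← lintegral_const_mul _ (by fun_prop), gammaMix]
    congr 1
    refine setLIntegral_congr_fun measurableSet_Ioi fun y hy => ?_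
    have hy' : (0 : ℝ) < y := hy
    have := hg0 (x * y) (mul_pos hx hy')
    rw [← ENNReal.ofReal_mul (by positivity), ← ENNReal.ofReal_mul (by positivity)]
    congr 1
    ring
  · filter_upwards [ae_restrict_mem measurableSet_Ioi] with y hy
    have hy' : (0 : ℝ) < y := hy
    have := hg0 (x * y) (mul_pos hx hy')
    simp only [Pi.zero_apply]
    positivity

/-- Multiplicative convolution identity: for `α < m < 2α`, the density solution
with parameters `(m, α)` is expressed in terms of the one with parameters
`(α, 2α−m)` via `f(x) = (1/Γ(α)) ∫_0^∞ g(xy) y^α e^{−y} dy`. -/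
theorem density_solution_gamma_factorization (α m : ℝ) (hα : 0 < α)
    (hm1 : α < m) (hm2 : m < 2 * α)
    (f g : ℝ → ℝ)
    (hf : IsDensitySolution α m f)
    (hg : IsDensitySolution (2 * α - m) α g) :
    ∀ x ∈ Set.Ioi (0:ℝ),
      f x = (1 / Real.Gamma α) *
        ∫ y in Set.Ioi (0:ℝ), g (x * y) * y ^ α * Real.exp (-y) := by
  intro x hx
  have hx' : (0 : ℝ) < x := hx
  have mf : Measurable fun v => ENNReal.ofReal (f v) := hf.1.ennreal_ofReal
  have mg : Measurable fun v => ENNReal.ofReal (g v) := hg.1.ennreal_ofReal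
  have hG := hg.isAESolution (by linarith)
  have hsol : ∀ z : ℝ, 0 < z → _ := fun z hz => gammaMix_solution hα hm2 hz mg hG
  have hmix : IsAESolution α m (gammaMix α fun v => ENNReal.ofReal (g v)) := by
    filter_upwards [ae_restrict_mem measurableSet_Ioi] with z hz using hsol z hz
  have hae := (hf.isAESolution hα).ae_eq hα hm1 mf (measurable_gammaMix α mg) hmix
    hf.negMoment_zero ((negMoment_gammaMix_zero hα mg).trans hg.negMoment_zero)
  have hfrac : fracInt α (fun v => ENNReal.ofReal (f v)) x
      = fracInt α (gammaMix α fun v => ENNReal.ofReal (g v)) x := by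
    refine lintegral_congr_ae ?_
    filter_upwards [hae] with v hv
    rw [hv]
  have heq := hf.2.2.2 x hx
  rw [toReal_fracInt hα hf.1 hf.2.1, hfrac, ← hsol x hx', ENNReal.toReal_mul,
    ENNReal.toReal_ofReal (by positivity), toReal_gammaMix hα hx' hg.1 hg.2.1] at heq
  exact mul_left_cancel₀ (rpow_pos_of_pos hx' m).ne' heq
end
end

section
/- Let n be a positive integer, m > n, set a = m − n, and let f be the unique density solution to the equation x^m f(x) = (1/Γ(n)) ∫_0^x (x−v)^{n−1} f(v) dv on (0,∞). Then for every s > −a, the Mellin transform satisfies ∫_0^∞ x^{−s} f(x) dx = a^{ns/a} · ∏_{i=1}^{n} Γ(1 + (i−1)/a + s/a) / Γ(1 + (i−1)/a). (Equivalently, f is the density of ( a^n Γ_1 × Γ_{1+1/a} × ⋯ × Γ_{1+(n−1)/a} )^{−1/a} for independent Gamma random variables.) -/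
open MeasureTheory Real Set Filter

noncomputable section

open scoped Topology ENNReal

/-- Two convex functions on `(-a, ∞)` with the same increments over steps of length `a` agree up to
a constant, provided these increments do not oscillate asymptotically along multiples of `a`. -/
theorem ConvexOn.eqOn_of_add_eq {a : ℝ} (ha : 0 < a) {g h φ : ℝ → ℝ}
    (hg : ConvexOn ℝ (Ioi (-a)) g) (hh : ConvexOn ℝ (Ioi (-a)) h)
    (hgφ : ∀ s, -a < s → g (s + a) = g s + φ s) (hhφ : ∀ s, -a < s → h (s + a) = h s + φ s)
    (h0 : g 0 = h 0)
    (hφ : Tendsto (fun k : ℕ => φ (((k + 1 : ℕ) : ℝ) * a) - φ ((k : ℝ) * a)) atTop (𝓝 0)) :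
    EqOn g h (Ioi (-a)) := by
  have periodic : ∀ (k : ℕ) (s : ℝ), -a < s → g (s + k * a) - h (s + k * a) = g s - h s := by
    intro k
    induction k with
    | zero => intro s _; simp
    | succ k ih =>
      intro s hs
      have hk : 0 ≤ (k : ℝ) * a := by positivity
      have e : s + ((k + 1 : ℕ) : ℝ) * a = s + k * a + a := by push_cast; ring
      rw [e, hgφ _ (by linarith), hhφ _ (by linarith), ← ih s hs]
      ring
  have bounds : ∀ {u : ℝ → ℝ}, ConvexOn ℝ (Ioi (-a)) u →
      (∀ s, -a < s → u (s + a) = u s + φ s) → ∀ (k : ℕ) (x : ℝ), 0 ≤ x → x ≤ a →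
      a * u (((k + 1 : ℕ) : ℝ) * a) + x * φ (k * a) ≤ a * u (x + ((k + 1 : ℕ) : ℝ) * a) ∧
      a * u (x + ((k + 1 : ℕ) : ℝ) * a) ≤
        a * u (((k + 1 : ℕ) : ℝ) * a) + x * φ (((k + 1 : ℕ) : ℝ) * a) := by
    intro u hu huφ k x hx hxa
    have hk : 0 ≤ (k : ℝ) * a := by positivity
    have e1 : ((k + 1 : ℕ) : ℝ) * a = k * a + a := by push_cast; ring
    have s1 := huφ (k * a) (by linarith)
    have s2 := huφ (k * a + a) (by linarith)
    rw [e1]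
    constructor
    · have c := hu.2 (show x + (k * a + a) ∈ Ioi (-a) by rw [mem_Ioi]; linarith)
        (show k * a ∈ Ioi (-a) by rw [mem_Ioi]; linarith)
        (show 0 ≤ a / (a + x) by positivity) (show 0 ≤ x / (a + x) by positivity)
        (by field_simp)
      simp only [smul_eq_mul] at c
      have e : a / (a + x) * (x + (k * a + a)) + x / (a + x) * (k * a) = k * a + a := by
        field_simp; ring
      rw [e] at c
      have c' := mul_le_mul_of_nonneg_left c (by positivity : 0 ≤ a + x)
      have e' : (a + x) * (a / (a + x) * u (x + (k * a + a)) + x / (a + x) * u (k * a))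
          = a * u (x + (k * a + a)) + x * u (k * a) := by field_simp
      rw [e'] at c'
      have : φ (k * a) = u (k * a + a) - u (k * a) := by linarith
      rw [this]
      linarith
    · have c := hu.2 (show k * a + a ∈ Ioi (-a) by rw [mem_Ioi]; linarith)
        (show k * a + a + a ∈ Ioi (-a) by rw [mem_Ioi]; linarith)
        (show 0 ≤ (a - x) / a from div_nonneg (by linarith) ha.le)
        (show 0 ≤ x / a by positivity) (by field_simp; ring)
      simp only [smul_eq_mul] at c
      have e : (a - x) / a * (k * a + a) + x / a * (k * a + a + a) = x + (k * a + a) := by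
        field_simp; ring
      rw [e, s2] at c
      have c' := mul_le_mul_of_nonneg_left c ha.le
      have e' : a * ((a - x) / a * u (k * a + a) + x / a * (u (k * a + a) + φ (k * a + a)))
          = a * u (k * a + a) + x * φ (k * a + a) := by field_simp; ring
      linarith
  have base : ∀ x, 0 ≤ x → x ≤ a → g x = h x := by
    intro x hx hxa
    have key : ∀ k : ℕ, |a * (g x - h x)| ≤
        x * (φ (((k + 1 : ℕ) : ℝ) * a) - φ ((k : ℝ) * a)) := by
      intro k
      obtain ⟨g1, g2⟩ := bounds hg hgφ k x hx hxa
      obtain ⟨h1, h2⟩ := bounds hh hhφ k x hx hxa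
      have p := periodic (k + 1) x (by linarith)
      have q := periodic (k + 1) 0 (by linarith)
      rw [h0, sub_self, zero_add, sub_eq_zero] at q
      rw [← p, abs_le]
      rw [q] at g1 g2
      constructor <;> linarith
    have lim := hφ.const_mul x
    rw [mul_zero] at lim
    have z : |a * (g x - h x)| ≤ 0 := ge_of_tendsto' lim key
    have z' := abs_nonpos_iff.mp z
    rcases mul_eq_zero.mp z' with h' | h' <;> linarith
  intro s hs
  rw [mem_Ioi] at hs
  rcases lt_or_ge s 0 with hneg | hpos
  · have p := periodic 1 s hs
    rw [base (s + (1 : ℕ) * a) (by push_cast; linarith) (by push_cast; linarith)] at p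
    linarith
  · have f1 := Nat.floor_le (div_nonneg hpos ha.le)
    have f2 := (Nat.lt_floor_add_one (s / a)).le
    rw [le_div_iff₀ ha] at f1
    rw [div_le_iff₀ ha] at f2
    have p := periodic ⌊s / a⌋₊ (s - ⌊s / a⌋₊ * a) (by linarith)
    rw [base (s - ⌊s / a⌋₊ * a) (by linarith) (by linarith), sub_add_cancel] at p
    linarith

theorem Real.Gamma_add_natCast_eq_prod_Icc {x : ℝ} (hx : 0 < x) (n : ℕ) :
    Real.Gamma (x + n) = (∏ i ∈ Finset.Icc 1 n, (x + ((i : ℝ) - 1))) * Real.Gamma x := by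
  induction n with
  | zero => simp
  | succ n ih =>
    rw [Finset.prod_Icc_succ_top (by omega), Nat.cast_succ, ← add_assoc,
      Real.Gamma_add_one (by positivity), ih]
    ring

theorem lintegral_Ioi_sub_rpow_mul_rpow {α t v : ℝ} (hα : 0 < α) (ht : α < t) (hv : 0 < v) :
    ∫⁻ x in Ioi v, ENNReal.ofReal ((x - v) ^ (α - 1) * x ^ (-t)) =
      ENNReal.ofReal (v ^ (α - t) * ProbabilityTheory.beta (t - α) α) := by
  have himage : (fun u : ℝ => v / u) '' Ioo 0 1 = Ioi v := by
    ext x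
    simp only [mem_image, mem_Ioo, mem_Ioi]
    constructor
    · rintro ⟨u, ⟨h0, h1⟩, rfl⟩
      rw [lt_div_iff₀ h0]
      nlinarith
    · intro hx
      have : 0 < x := hv.trans hx
      exact ⟨v / x, ⟨by positivity, (div_lt_one this).mpr hx⟩, by field_simp⟩
  have hderiv : ∀ u ∈ Ioo (0 : ℝ) 1,
      HasDerivWithinAt (fun u : ℝ => v / u) (-v / u ^ 2) (Ioo 0 1) u := by
    intro u hu
    have := ((hasDerivAt_inv hu.1.ne').const_mul v).hasDerivWithinAt (s := Ioo 0 1)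
    simpa [div_eq_mul_inv] using this
  have hinj : InjOn (fun u : ℝ => v / u) (Ioo 0 1) := by
    intro x hx y hy hxy
    have h1 := hx.1.ne'
    have h2 := hy.1.ne'
    have h3 := hv.ne'
    simp only at hxy
    field_simp at hxy
    exact hxy.symm
  have hb := ProbabilityTheory.beta_pos (sub_pos.mpr ht) hα
  have hone := ProbabilityTheory.lintegral_betaPDF_eq_one (sub_pos.mpr ht) hα
  rw [ProbabilityTheory.lintegral_betaPDF] at hone
  rw [← himage, lintegral_image_eq_lintegral_abs_deriv_mul measurableSet_Ioo hderiv hinj,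
    ← mul_one (ENNReal.ofReal (v ^ (α - t) * _)), ← hone, ← lintegral_const_mul _ (by fun_prop)]
  refine setLIntegral_congr_fun measurableSet_Ioo fun u ⟨hu0, hu1⟩ => ?_
  rw [← ENNReal.ofReal_mul (by positivity), ← ENNReal.ofReal_mul (by positivity)]
  congr 1
  have hu1' : 0 < 1 - u := by linarith
  have e1 : v / u - v = v * (1 - u) / u := by field_simp
  have e2 : |-v / u ^ 2| = v * u ^ (-2 : ℝ) := by
    rw [abs_div, abs_neg, abs_of_pos hv, abs_of_pos (by positivity), rpow_neg hu0.le,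
      div_eq_mul_inv]
    norm_num
  rw [e1, e2, div_rpow (by positivity) hu0.le, mul_rpow hv.le hu1'.le, div_rpow hv.le hu0.le]
  have e3 : v ^ (α - t) = v * v ^ (α - 1) * v ^ (-t) := by
    rw [← rpow_one_add' hv.le (by simpa using hα.ne'), ← rpow_add hv]
    ring_nf
  have e4 : u ^ (t - α - 1) = u ^ (-2 : ℝ) / u ^ (α - 1) / u ^ (-t) := by
    rw [← rpow_sub hu0, ← rpow_sub hu0]
    ring_nf
  rw [e3, e4]
  field_simp

/-- The integral of `x ^ (-s) * f x` over `(0, ∞)`, as an extended nonnegative real. -/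
def lintegralRpowNeg (f : ℝ → ℝ) (s : ℝ) : ℝ≥0∞ :=
  ∫⁻ x in Ioi (0 : ℝ), ENNReal.ofReal (x ^ (-s) * f x)

theorem lintegralRpowNeg_convex_comb_le {f : ℝ → ℝ} (hfm : Measurable f)
    (hf0 : ∀ x ∈ Ioi (0 : ℝ), 0 ≤ f x) (s t : ℝ) {p q : ℝ} (hp : 0 ≤ p) (hq : 0 ≤ q)
    (hpq : p + q = 1) :
    lintegralRpowNeg f (p * s + q * t) ≤ lintegralRpowNeg f s ^ p * lintegralRpowNeg f t ^ q := by
  refine le_trans (le_of_eq ?_) (ENNReal.lintegral_mul_norm_pow_le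
    (by fun_prop) (by fun_prop) hp hq hpq)
  refine setLIntegral_congr_fun measurableSet_Ioi fun x hx => ?_
  have hx' : 0 < x := hx
  have hfx := hf0 x hx
  rw [ENNReal.ofReal_rpow_of_nonneg (by positivity) hp,
    ENNReal.ofReal_rpow_of_nonneg (by positivity) hq, ← ENNReal.ofReal_mul (by positivity),
    mul_rpow (by positivity) hfx, mul_rpow (by positivity) hfx, ← rpow_mul hx'.le,
    ← rpow_mul hx'.le]
  have e1 : x ^ (-(p * s + q * t)) = x ^ (-s * p) * x ^ (-t * q) := by
    rw [← rpow_add hx']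
    ring_nf
  have e2 : f x = f x ^ p * f x ^ q := by
    rw [← rpow_add' hfx (by rw [hpq]; exact one_ne_zero), hpq, rpow_one]
  rw [e1]
  nth_rewrite 1 [e2]
  congr 1
  ring

theorem IsDensitySolution.integrableOn {α m : ℝ} {f : ℝ → ℝ} (hf : IsDensitySolution α m f) :
    IntegrableOn f (Ioi 0) :=
  Integrable.of_integral_ne_zero (by rw [hf.2.2.1]; exact one_ne_zero)

theorem IsDensitySolution.lintegralRpowNeg_zero {α m : ℝ} {f : ℝ → ℝ}
    (hf : IsDensitySolution α m f) : lintegralRpowNeg f 0 = 1 := by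
  have h := ofReal_integral_eq_lintegral_ofReal hf.integrableOn
    (ae_restrict_of_forall_mem measurableSet_Ioi hf.2.1)
  rw [hf.2.2.1, ENNReal.ofReal_one] at h
  simpa [lintegralRpowNeg] using h.symm

theorem IsDensitySolution.lintegralRpowNeg_ne_zero {α m : ℝ} {f : ℝ → ℝ}
    (hf : IsDensitySolution α m f) (s : ℝ) : lintegralRpowNeg f s ≠ 0 := by
  have hfm := hf.1
  intro h0
  rw [lintegralRpowNeg, lintegral_eq_zero_iff (by fun_prop)] at h0
  have hae : ∀ᵐ x ∂volume.restrict (Ioi (0 : ℝ)), f x = 0 := by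
    filter_upwards [h0, ae_restrict_mem measurableSet_Ioi] with x hx hx0
    have hpos : 0 < x ^ (-s) := rpow_pos_of_pos hx0 _
    have hle : x ^ (-s) * f x ≤ 0 := by simpa using hx
    exact le_antisymm (by by_contra! hlt; exact absurd hle (not_le.mpr (mul_pos hpos hlt)))
      (hf.2.1 x hx0)
  have hf_int := hf.2.2.1
  rw [integral_congr_ae hae] at hf_int
  simp at hf_int

/-- Mellin transform of the equation `I^α_{0+} f = x^m f`. -/
theorem IsDensitySolution.ofReal_Gamma_mul_lintegralRpowNeg {α m t : ℝ} {f : ℝ → ℝ} (hα : 1 ≤ α)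
    (hf : IsDensitySolution α m f) (ht : α < t) :
    ENNReal.ofReal (Real.Gamma t) * lintegralRpowNeg f (t - m) =
      ENNReal.ofReal (Real.Gamma (t - α)) * lintegralRpowNeg f (t - α) := by
  obtain ⟨hfm, hf0, -, heq⟩ := id hf
  have hα0 : 0 < α := by linarith
  have hΓα : 0 < Real.Gamma α := Real.Gamma_pos_of_pos hα0
  have hΓt : 0 < Real.Gamma t := Real.Gamma_pos_of_pos (by linarith)
  have hΓtα : 0 < Real.Gamma (t - α) := Real.Gamma_pos_of_pos (by linarith)
  set k : ℝ → ℝ → ℝ≥0∞ := fun x v =>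
    ENNReal.ofReal (1 / Real.Gamma α * (x ^ (-t) * ((x - v) ^ (α - 1) * f v))) with hk
  have hleft : lintegralRpowNeg f (t - m) =
      ∫⁻ x in Ioi (0 : ℝ), ∫⁻ v in Ioi (0 : ℝ), (Iio x).indicator (k x) v := by
    refine setLIntegral_congr_fun measurableSet_Ioi fun x hx => ?_
    have hx' : 0 < x := hx
    have hIoo : Iio x ∩ Ioi 0 = Ioo 0 x := by rw [inter_comm]; rfl
    rw [setLIntegral_indicator measurableSet_Iio, hIoo]
    have hnonneg : ∀ v ∈ Ioo 0 x, 0 ≤ (x - v) ^ (α - 1) * f v := fun v hv =>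
      mul_nonneg (rpow_nonneg (by linarith [hv.2]) _) (hf0 v hv.1)
    have hf_int : IntegrableOn (fun v => (x - v) ^ (α - 1) * f v) (Ioo 0 x) := by
      refine Integrable.bdd_mul (c := x ^ (α - 1)) (hf.integrableOn.mono_set Ioo_subset_Ioi_self)
        (Measurable.aestronglyMeasurable (by fun_prop))
        (ae_restrict_of_forall_mem measurableSet_Ioo fun v hv => ?_)
      have hxv : 0 ≤ x - v := by linarith [hv.2]
      rw [Real.norm_of_nonneg (rpow_nonneg hxv _)]
      exact rpow_le_rpow hxv (by linarith [hv.1]) (by linarith)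
    have e1 : x ^ (-(t - m)) * f x = 1 / Real.Gamma α * x ^ (-t) *
        ∫ v in Ioo 0 x, (x - v) ^ (α - 1) * f v := by
      have e2 : x ^ (-(t - m)) = x ^ (-t) * x ^ m := by rw [← rpow_add hx']; ring_nf
      rw [e2, mul_assoc, heq x hx]
      ring
    rw [e1, ENNReal.ofReal_mul (by positivity), ofReal_integral_eq_lintegral_ofReal hf_int
      (ae_restrict_of_forall_mem measurableSet_Ioo hnonneg), ← lintegral_const_mul _ (by fun_prop)]
    refine setLIntegral_congr_fun measurableSet_Ioo fun v hv => ?_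
    simp only [hk]
    rw [← ENNReal.ofReal_mul (by positivity), mul_assoc]
  have hmeas : Measurable (Function.uncurry fun x v : ℝ => (Iio x).indicator (k x) v) := by
    have : (Function.uncurry fun x v : ℝ => (Iio x).indicator (k x) v) =
        {p : ℝ × ℝ | p.2 < p.1}.indicator (Function.uncurry k) := by
      ext ⟨x, v⟩
      simp [indicator]
    rw [this]
    refine Measurable.indicator ?_ (measurableSet_lt measurable_snd measurable_fst)
    simp only [hk, Function.uncurry_def]
    fun_prop
  rw [hleft, lintegral_lintegral_swap hmeas.aemeasurable, lintegralRpowNeg,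
    ← lintegral_const_mul' _ _ ENNReal.ofReal_ne_top,
    ← lintegral_const_mul' _ _ ENNReal.ofReal_ne_top]
  refine setLIntegral_congr_fun measurableSet_Ioi fun v hv => ?_
  have hv' : 0 < v := hv
  have hfv := hf0 v hv
  have hinner : ∫⁻ x in Ioi (0 : ℝ), (Iio x).indicator (k x) v =
      ENNReal.ofReal (1 / Real.Gamma α * f v) *
        ENNReal.ofReal (v ^ (α - t) * ProbabilityTheory.beta (t - α) α) := by
    have : ∀ x, (Iio x).indicator (k x) v = (Ioi v).indicator (fun x => k x v) x := fun x => by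
      simp [indicator]
    simp_rw [this]
    rw [setLIntegral_indicator measurableSet_Ioi, inter_eq_left.mpr (Ioi_subset_Ioi hv'.le),
      ← lintegral_Ioi_sub_rpow_mul_rpow hα0 ht hv', ← lintegral_const_mul _ (by fun_prop)]
    refine setLIntegral_congr_fun measurableSet_Ioi fun x _ => ?_
    simp only [hk]
    rw [← ENNReal.ofReal_mul (by positivity)]
    congr 1
    ring
  rw [hinner, ← ENNReal.ofReal_mul (by positivity), ← ENNReal.ofReal_mul hΓt.le,
    ← ENNReal.ofReal_mul hΓtα.le, ProbabilityTheory.beta, sub_add_cancel, neg_sub]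
  congr 1
  field_simp

theorem IsDensitySolution.lintegralRpowNeg_add {n : ℕ} (hn : 0 < n) {m a : ℝ} (ha : a = m - n)
    {f : ℝ → ℝ} (hf : IsDensitySolution n m f) {s : ℝ} (hs : -a < s) :
    lintegralRpowNeg f (s + a) =
      ENNReal.ofReal (∏ i ∈ Finset.Icc 1 n, (s + a + ((i : ℝ) - 1))) * lintegralRpowNeg f s := by
  have hsa : 0 < s + a := by linarith
  have hΓ := Real.Gamma_pos_of_pos hsa
  have h := hf.ofReal_Gamma_mul_lintegralRpowNeg (t := s + a + n) (by exact_mod_cast hn)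
    (by linarith)
  rw [add_sub_cancel_right, show s + a + n - m = s by rw [ha]; ring,
    Real.Gamma_add_natCast_eq_prod_Icc hsa, ENNReal.ofReal_mul' hΓ.le,
    mul_comm (ENNReal.ofReal (∏ i ∈ _, _)), mul_assoc] at h
  exact ((ENNReal.mul_right_inj (ENNReal.ofReal_pos.mpr hΓ).ne' ENNReal.ofReal_ne_top).mp h).symm

theorem prod_Icc_add_natCast_sub_one_pos {x : ℝ} (hx : 0 < x) (n : ℕ) :
    0 < ∏ i ∈ Finset.Icc 1 n, (x + ((i : ℝ) - 1)) := by
  refine Finset.prod_pos fun i hi => ?_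
  have : (1 : ℝ) ≤ i := by exact_mod_cast (Finset.mem_Icc.mp hi).1
  linarith

theorem IsDensitySolution.lintegralRpowNeg_ne_top {n : ℕ} (hn : 0 < n) {m a : ℝ}
    (ha : a = m - n) (ha0 : 0 < a) {f : ℝ → ℝ} (hf : IsDensitySolution n m f) {s : ℝ}
    (hs : -a < s) : lintegralRpowNeg f s ≠ ⊤ := by
  have hmul : ∀ k : ℕ, lintegralRpowNeg f (k * a) ≠ ⊤ := by
    intro k
    induction k with
    | zero => simp [hf.lintegralRpowNeg_zero]
    | succ k ih =>
      have hk : 0 ≤ (k : ℝ) * a := by positivity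
      rw [Nat.cast_succ, add_one_mul, hf.lintegralRpowNeg_add hn ha (by linarith)]
      exact ENNReal.mul_ne_top ENNReal.ofReal_ne_top ih
  have hnonneg : ∀ t, 0 ≤ t → lintegralRpowNeg f t ≠ ⊤ := by
    intro t ht
    obtain ⟨k, hk⟩ := exists_nat_gt (t / a)
    have hk0 : (0 : ℝ) < k := lt_of_le_of_lt (by positivity) hk
    rw [div_lt_iff₀ ha0] at hk
    have hle : t / (k * a) ≤ 1 := (div_le_one (by positivity)).mpr hk.le
    have h := lintegralRpowNeg_convex_comb_le hf.1 hf.2.1 (k * a) 0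
      (show 0 ≤ t / (k * a) by positivity) (sub_nonneg.mpr hle) (by ring)
    rw [mul_zero, add_zero, div_mul_cancel₀ _ (by positivity), hf.lintegralRpowNeg_zero,
      ENNReal.one_rpow, mul_one] at h
    exact ne_top_of_le_ne_top (ENNReal.rpow_ne_top_of_nonneg (by positivity) (hmul k)) h
  have h := hf.lintegralRpowNeg_add hn ha hs
  intro htop
  rw [htop, ENNReal.mul_top
    (ENNReal.ofReal_pos.mpr (prod_Icc_add_natCast_sub_one_pos (by linarith) n)).ne'] at h
  exact hnonneg (s + a) (by linarith) h

theorem IsDensitySolution.convexOn_log_toReal_lintegralRpowNeg {n : ℕ} (hn : 0 < n) {m a : ℝ}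
    (ha : a = m - n) (ha0 : 0 < a) {f : ℝ → ℝ} (hf : IsDensitySolution n m f) :
    ConvexOn ℝ (Ioi (-a)) fun s => Real.log (lintegralRpowNeg f s).toReal := by
  refine ⟨convex_Ioi _, fun s hs t ht p q hp hq hpq => ?_⟩
  have hst : p • s + q • t ∈ Ioi (-a) := convex_Ioi (-a) hs ht hp hq hpq
  have hpos : ∀ u, -a < u → 0 < (lintegralRpowNeg f u).toReal := fun u hu =>
    ENNReal.toReal_pos (hf.lintegralRpowNeg_ne_zero u) (hf.lintegralRpowNeg_ne_top hn ha ha0 hu)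
  have h := ENNReal.toReal_mono
    (ENNReal.mul_ne_top
      (ENNReal.rpow_ne_top_of_nonneg hp (hf.lintegralRpowNeg_ne_top hn ha ha0 hs))
      (ENNReal.rpow_ne_top_of_nonneg hq (hf.lintegralRpowNeg_ne_top hn ha ha0 ht)))
    (lintegralRpowNeg_convex_comb_le hf.1 hf.2.1 s t hp hq hpq)
  rw [ENNReal.toReal_mul, ← ENNReal.toReal_rpow, ← ENNReal.toReal_rpow] at h
  have hs' := hpos s hs
  have ht' := hpos t ht
  calc Real.log (lintegralRpowNeg f (p • s + q • t)).toReal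
      ≤ Real.log ((lintegralRpowNeg f s).toReal ^ p * (lintegralRpowNeg f t).toReal ^ q) :=
        Real.log_le_log (hpos _ hst) h
    _ = _ := by
      rw [Real.log_mul (by positivity) (by positivity), Real.log_rpow hs', Real.log_rpow ht']
      rfl

/-- The Mellin transform of `(a^n Γ_1 × Γ_{1+1/a} × ⋯ × Γ_{1+(n-1)/a})^{-1/a}` at `1 - s`. -/
def gammaProductMellin (n : ℕ) (a s : ℝ) : ℝ :=
  a ^ ((n : ℝ) * s / a) *
    ∏ i ∈ Finset.Icc 1 n,
      Real.Gamma (1 + ((i : ℝ) - 1) / a + s / a) / Real.Gamma (1 + ((i : ℝ) - 1) / a)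

section gammaProductMellin

variable {n : ℕ} {a : ℝ}

theorem one_add_div_add_div_pos {i : ℕ} (hi : i ∈ Finset.Icc 1 n) (ha : 0 < a) {s : ℝ}
    (hs : -a < s) : 0 < 1 + ((i : ℝ) - 1) / a + s / a := by
  have hi1 : (1 : ℝ) ≤ i := by exact_mod_cast (Finset.mem_Icc.mp hi).1
  have : 1 + ((i : ℝ) - 1) / a + s / a = (s + a + (i - 1)) / a := by field_simp; ring
  rw [this]
  exact div_pos (by linarith) ha

theorem one_add_div_pos {i : ℕ} (hi : i ∈ Finset.Icc 1 n) (ha : 0 < a) :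
    0 < 1 + ((i : ℝ) - 1) / a := by
  simpa using one_add_div_add_div_pos hi ha (s := 0) (by linarith)

theorem gammaProductMellin_pos (ha : 0 < a) {s : ℝ} (hs : -a < s) :
    0 < gammaProductMellin n a s :=
  mul_pos (rpow_pos_of_pos ha _) (Finset.prod_pos fun _ hi =>
    div_pos (Real.Gamma_pos_of_pos (one_add_div_add_div_pos hi ha hs))
      (Real.Gamma_pos_of_pos (one_add_div_pos hi ha)))

theorem gammaProductMellin_zero (ha : 0 < a) : gammaProductMellin n a 0 = 1 := by
  rw [gammaProductMellin, mul_zero, zero_div, rpow_zero, one_mul]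
  refine Finset.prod_eq_one fun i hi => ?_
  rw [add_zero, div_self (Real.Gamma_pos_of_pos (one_add_div_pos hi ha)).ne']

theorem gammaProductMellin_add (ha : 0 < a) {s : ℝ} (hs : -a < s) :
    gammaProductMellin n a (s + a) =
      (∏ i ∈ Finset.Icc 1 n, (s + a + ((i : ℝ) - 1))) * gammaProductMellin n a s := by
  have hterm : ∀ i ∈ Finset.Icc 1 n,
      Real.Gamma (1 + ((i : ℝ) - 1) / a + (s + a) / a) / Real.Gamma (1 + ((i : ℝ) - 1) / a) =
        a⁻¹ * ((s + a + ((i : ℝ) - 1)) * (Real.Gamma (1 + ((i : ℝ) - 1) / a + s / a) /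
          Real.Gamma (1 + ((i : ℝ) - 1) / a))) := by
    intro i hi
    have e : 1 + ((i : ℝ) - 1) / a + (s + a) / a = 1 + ((i : ℝ) - 1) / a + s / a + 1 := by
      field_simp
      ring
    rw [e, Real.Gamma_add_one (one_add_div_add_div_pos hi ha hs).ne']
    have e' : 1 + ((i : ℝ) - 1) / a + s / a = a⁻¹ * (s + a + (i - 1)) := by field_simp; ring
    nth_rewrite 1 [e']
    ring
  have hpow : a ^ ((n : ℝ) * (s + a) / a) = a ^ ((n : ℝ) * s / a) * a ^ n := by
    rw [← rpow_natCast, ← rpow_add ha]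
    congr 1
    field_simp
  rw [gammaProductMellin, gammaProductMellin, Finset.prod_congr rfl hterm,
    Finset.prod_mul_distrib, Finset.prod_mul_distrib, hpow, Finset.prod_const, Nat.card_Icc,
    Nat.add_sub_cancel, inv_pow]
  field_simp

theorem log_gammaProductMellin (ha : 0 < a) {s : ℝ} (hs : -a < s) :
    Real.log (gammaProductMellin n a s) = n * Real.log a / a * s +
      ∑ i ∈ Finset.Icc 1 n, (Real.log (Real.Gamma (1 + ((i : ℝ) - 1) / a + s / a)) -
        Real.log (Real.Gamma (1 + ((i : ℝ) - 1) / a))) := by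
  have h1 : ∀ i ∈ Finset.Icc 1 n, Real.Gamma (1 + ((i : ℝ) - 1) / a + s / a) ≠ 0 := fun i hi =>
    (Real.Gamma_pos_of_pos (one_add_div_add_div_pos hi ha hs)).ne'
  have h2 : ∀ i ∈ Finset.Icc 1 n, Real.Gamma (1 + ((i : ℝ) - 1) / a) ≠ 0 := fun i hi =>
    (Real.Gamma_pos_of_pos (one_add_div_pos hi ha)).ne'
  rw [gammaProductMellin, Real.log_mul (rpow_pos_of_pos ha _).ne'
    (Finset.prod_ne_zero_iff.mpr fun i hi => div_ne_zero (h1 i hi) (h2 i hi)),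
    Real.log_rpow ha, Real.log_prod fun i hi => div_ne_zero (h1 i hi) (h2 i hi),
    Finset.sum_congr rfl fun i hi => Real.log_div (h1 i hi) (h2 i hi)]
  ring

theorem convexOn_log_gammaProductMellin (ha : 0 < a) :
    ConvexOn ℝ (Ioi (-a)) fun s => Real.log (gammaProductMellin n a s) := by
  refine ⟨convex_Ioi _, fun s hs t ht p q hp hq hpq => ?_⟩
  have hst : p • s + q • t ∈ Ioi (-a) := convex_Ioi (-a) hs ht hp hq hpq
  simp only
  rw [log_gammaProductMellin ha hs, log_gammaProductMellin ha ht, log_gammaProductMellin ha hst]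
  simp only [smul_eq_mul, mul_add, Finset.mul_sum]
  have hsum : ∑ i ∈ Finset.Icc 1 n,
      (Real.log (Real.Gamma (1 + ((i : ℝ) - 1) / a + (p * s + q * t) / a)) -
        Real.log (Real.Gamma (1 + ((i : ℝ) - 1) / a))) ≤
      ∑ i ∈ Finset.Icc 1 n, p * (Real.log (Real.Gamma (1 + ((i : ℝ) - 1) / a + s / a)) -
        Real.log (Real.Gamma (1 + ((i : ℝ) - 1) / a))) +
      ∑ i ∈ Finset.Icc 1 n, q * (Real.log (Real.Gamma (1 + ((i : ℝ) - 1) / a + t / a)) -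
        Real.log (Real.Gamma (1 + ((i : ℝ) - 1) / a))) := by
    rw [← Finset.sum_add_distrib]
    refine Finset.sum_le_sum fun i hi => ?_
    have h := Real.convexOn_log_Gamma.2 (one_add_div_add_div_pos hi ha hs)
      (one_add_div_add_div_pos hi ha ht) hp hq hpq
    simp only [smul_eq_mul, Function.comp_apply] at h
    obtain rfl : q = 1 - p := by linarith
    have e : p * (1 + ((i : ℝ) - 1) / a + s / a) + (1 - p) * (1 + ((i : ℝ) - 1) / a + t / a) =
        1 + ((i : ℝ) - 1) / a + (p * s + (1 - p) * t) / a := by ring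
    rw [e] at h
    linarith
  linarith

end gammaProductMellin

theorem tendsto_sum_log_sub_log {a : ℝ} (ha : 0 < a) (n : ℕ) :
    Tendsto (fun k : ℕ =>
      ∑ i ∈ Finset.Icc 1 n, Real.log (((k + 1 : ℕ) : ℝ) * a + a + ((i : ℝ) - 1)) -
        ∑ i ∈ Finset.Icc 1 n, Real.log ((k : ℝ) * a + a + ((i : ℝ) - 1))) atTop (𝓝 0) := by
  simp_rw [← Finset.sum_sub_distrib]
  rw [← Finset.sum_const_zero (s := Finset.Icc 1 n)]
  refine tendsto_finsetSum _ fun i _ => ?_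
  have hlin : Tendsto (fun k : ℕ => (k : ℝ) * a + a + ((i : ℝ) - 1)) atTop atTop :=
    tendsto_atTop_add_const_right _ _ (tendsto_atTop_add_const_right _ _
      (tendsto_natCast_atTop_atTop.atTop_mul_const ha))
  refine ((Real.tendsto_log_comp_add_sub_log a).comp hlin).congr fun k => ?_
  simp only [Function.comp_apply]
  push_cast
  ring_nf

/-- For `α = n` a positive integer and `m > n`, with `a = m − n`, the Mellin
transform of the density solution is
`a^{ns/a} ∏_{i=1}^n Γ(1+(i−1)/a+s/a)/Γ(1+(i−1)/a)` for `s > −a`. -/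
theorem density_solution_integer_alpha_mellin (n : ℕ) (hn : 0 < n)
    (m : ℝ) (hm : (n : ℝ) < m) (a : ℝ) (ha : a = m - n)
    (f : ℝ → ℝ) (hf : IsDensitySolution (n : ℝ) m f) :
    ∀ s : ℝ, -a < s →
      (∫ x in Set.Ioi (0:ℝ), x ^ (-s) * f x) =
        a ^ ((n : ℝ) * s / a) *
          ∏ i ∈ Finset.Icc 1 n,
            Real.Gamma (1 + ((i : ℝ) - 1) / a + s / a) /
              Real.Gamma (1 + ((i : ℝ) - 1) / a) := by
  have ha0 : 0 < a := by linarith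
  have hpos : ∀ u, -a < u → 0 < (lintegralRpowNeg f u).toReal := fun u hu =>
    ENNReal.toReal_pos (hf.lintegralRpowNeg_ne_zero u) (hf.lintegralRpowNeg_ne_top hn ha ha0 hu)
  have hlog_prod : ∀ u, -a < u → Real.log (∏ i ∈ Finset.Icc 1 n, (u + a + ((i : ℝ) - 1))) =
      ∑ i ∈ Finset.Icc 1 n, Real.log (u + a + ((i : ℝ) - 1)) := fun u hu =>
    Real.log_prod (Finset.prod_ne_zero_iff.mp
      (prod_Icc_add_natCast_sub_one_pos (show 0 < u + a by linarith) n).ne')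
  have heq := ConvexOn.eqOn_of_add_eq ha0
    (φ := fun u => ∑ i ∈ Finset.Icc 1 n, Real.log (u + a + ((i : ℝ) - 1)))
    (hf.convexOn_log_toReal_lintegralRpowNeg hn ha ha0)
    (convexOn_log_gammaProductMellin (n := n) ha0)
    (fun u hu => by
      have hprod := prod_Icc_add_natCast_sub_one_pos (show 0 < u + a by linarith) n
      rw [hf.lintegralRpowNeg_add hn ha hu, ENNReal.toReal_mul, ENNReal.toReal_ofReal hprod.le,
        Real.log_mul hprod.ne' (hpos u hu).ne', hlog_prod u hu, add_comm])
    (fun u hu => by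
      have hprod := prod_Icc_add_natCast_sub_one_pos (show 0 < u + a by linarith) n
      rw [gammaProductMellin_add ha0 hu,
        Real.log_mul hprod.ne' (gammaProductMellin_pos ha0 hu).ne', hlog_prod u hu, add_comm])
    (by simp [hf.lintegralRpowNeg_zero, gammaProductMellin_zero ha0])
    (tendsto_sum_log_sub_log ha0 n)
  intro s hs
  have hfm := hf.1
  rw [integral_eq_lintegral_of_nonneg_ae
    (ae_restrict_of_forall_mem measurableSet_Ioi fun x hx =>
      mul_nonneg (rpow_nonneg (mem_Ioi.mp hx).le _) (hf.2.1 x hx))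
    (Measurable.aestronglyMeasurable (by fun_prop))]
  exact Real.log_injOn_pos (hpos s hs) (gammaProductMellin_pos ha0 hs) (heq hs)
end
end
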